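/- Quenched linear response (abstract form): under hypotheses (1)–(5) of Theorem 3 — decay ‖L^n_{ω,ε}h‖_w ≤ Ce^{-λn}‖h‖_w on ker ψ; continuity estimate ‖L_{ω,ε}h − L_{ω'}h‖_w ≤ C(d(ω,ω')^ζ+|ε|^ζ)‖h‖_s; ‖h_{ω,ε}‖_s ≤ C, ψ(h_{ω,ε})=1, equivariance; sup_j ‖L^j_ω‖_s ≤ K; ‖h_ω‖_ss ≤ C; first-order Taylor estimate ‖(L_{γ(ε),ε} − L_{γ(0),0})g − ε (∂L)g‖_s ≤ C(|ε|^{1+ζ} + d(γ(ε),γ(0))^{1+ζ})‖g‖_ss for differentiable curves γ; Lip(σ^{-k}) ≤ Ce^{ck} with c < λ/(1+ζ); dist_{C⁰}(σ⁻¹,σ_ε⁻¹) = O(ε); and sup_{ω,j}‖Λ_{ω,j}‖ < ∞ — then for every ω ∈ Ω_ε ∩ Ω₀, ‖h_{ω,ε} − h_ω − ε Γ_ω‖_w = O(|ln|ε|| · |ε|^{1+ζ}), where Γ_ω = Σ_{j≥0} L^j_{σ^{-j}ω} Λ_{ω,j} h_{σ^{-(j+1)}ω}. In particular ε ↦ h_{ω,ε}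 is differentiable at 0 in B_w with derivative Γ_ω. -/

import Mathlib

/-- The random cocycle L^n_{ω,ε} = L_{σ_ε^{n-1}ω,ε} ∘ ⋯ ∘ L_{ω,ε} (and L⁰ = Id). -/
noncomputable def coc {Ω B : Type*} [NormedAddCommGroup B] [NormedSpace ℝ B]
    (σ : Ω → Ω) (L : Ω → B →L[ℝ] B) : ℕ → Ω → (B →L[ℝ] B)
  | 0, _ => ContinuousLinearMap.id ℝ B
  | n + 1, ω => (coc σ L n (σ ω)).comp (L ω)

section Cocycle

variable {Ω B B' : Type*} [NormedAddCommGroup B] [NormedSpace ℝ B]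
  [NormedAddCommGroup B'] [NormedSpace ℝ B']

theorem coc_succ_comp (σ : Ω → Ω) (L : Ω → B →L[ℝ] B) (n : ℕ) (ω : Ω) :
    coc σ L (n + 1) ω = (L (σ^[n] ω)).comp (coc σ L n ω) := by
  induction n generalizing ω with
  | zero => ext; simp [coc]
  | succ n ih =>
    rw [coc, ih (σ ω), coc, ContinuousLinearMap.comp_assoc, Function.iterate_succ_apply]

theorem coc_symm_iterate_succ (σ : Ω ≃ Ω) (L : Ω → B →L[ℝ] B) (n : ℕ) (ω : Ω) :
    coc σ L (n + 1) (σ.symm^[n + 1] ω) =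
      (coc σ L n (σ.symm^[n] ω)).comp (L (σ.symm^[n + 1] ω)) := by
  rw [coc, Function.iterate_succ_apply', Equiv.apply_symm_apply]

theorem iterate_symm_iterate_add (σ : Ω ≃ Ω) (n m : ℕ) (ω : Ω) :
    σ^[m] (σ.symm^[n + m] ω) = σ.symm^[n] ω := by
  rw [Nat.add_comm, Function.iterate_add_apply]
  exact (Function.LeftInverse.iterate σ.apply_symm_apply m) _

/-- Telescoping expansion of the difference of two equivariant families along backward orbits. -/
theorem equivariant_sub_eq_sum (σ τ : Ω ≃ Ω) (L : Ω → B →L[ℝ] B) (u v : Ω → B) (ω : Ω)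
    (hu : ∀ n, L (σ.symm^[n + 1] ω) (u (σ.symm^[n + 1] ω)) = u (σ.symm^[n] ω)) (n : ℕ) :
    u ω - v ω = coc σ L n (σ.symm^[n] ω) (u (σ.symm^[n] ω) - v (τ.symm^[n] ω)) +
      ∑ j ∈ Finset.range n, coc σ L j (σ.symm^[j] ω)
        (L (σ.symm^[j + 1] ω) (v (τ.symm^[j + 1] ω)) - v (τ.symm^[j] ω)) := by
  induction n with
  | zero => simp [coc]
  | succ n ih =>
    rw [ih, Finset.sum_range_succ, coc_symm_iterate_succ]
    simp only [ContinuousLinearMap.comp_apply, map_sub, hu]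
    abel

/-- Two cocycles of a weak space, one of which restricts to a bounded cocycle of a strong space,
differ along backward orbits by at most the sum of the one-step errors. -/
theorem norm_coc_sub_coc_le (ι : B' →L[ℝ] B) (σ τ : Ω ≃ Ω) (L M : Ω → B →L[ℝ] B)
    (M' : Ω → B' →L[ℝ] B') (hM : ∀ ω g, ι (M' ω g) = M ω (ι g)) {K : ℝ}
    (hK : ∀ ω j, ‖coc τ M' j ω‖ ≤ K) (ω : Ω) (a : ℕ → ℝ) (ha : ∀ i, 0 ≤ a i)
    (hstep : ∀ i (g : B'), ‖coc σ L i (σ.symm^[i] ω)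
      (L (σ.symm^[i + 1] ω) (ι g) - M (τ.symm^[i + 1] ω) (ι g))‖ ≤ a i * ‖g‖)
    (n : ℕ) (g : B') :
    ‖coc σ L n (σ.symm^[n] ω) (ι g) - coc τ M n (τ.symm^[n] ω) (ι g)‖ ≤
      (∑ i ∈ Finset.range n, a i) * (K * ‖g‖) := by
  suffices H : ∀ m, ‖coc σ L n (σ.symm^[n] ω) (ι (coc τ M' m (τ.symm^[n + m] ω) g)) -
      coc τ M n (τ.symm^[n] ω) (ι (coc τ M' m (τ.symm^[n + m] ω) g))‖ ≤
      (∑ i ∈ Finset.range n, a i) * (K * ‖g‖) by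
    simpa [coc] using H 0
  induction n with
  | zero => simp [coc]
  | succ n ih =>
    intro m
    set u := coc τ M' m (τ.symm^[n + 1 + m] ω) g with hu
    have hu_norm : ‖u‖ ≤ K * ‖g‖ :=
      (ContinuousLinearMap.le_opNorm _ _).trans
        (mul_le_mul_of_nonneg_right (hK _ _) (norm_nonneg _))
    have hnext : M (τ.symm^[n + 1] ω) (ι u) =
        ι (coc τ M' (m + 1) (τ.symm^[n + (m + 1)] ω) g) := by
      rw [coc_succ_comp, ContinuousLinearMap.comp_apply, hM,
        show n + (m + 1) = n + 1 + m by ring, iterate_symm_iterate_add]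
    have hsplit : coc σ L (n + 1) (σ.symm^[n + 1] ω) (ι u) -
        coc τ M (n + 1) (τ.symm^[n + 1] ω) (ι u) =
        (coc σ L n (σ.symm^[n] ω) (M (τ.symm^[n + 1] ω) (ι u)) -
          coc τ M n (τ.symm^[n] ω) (M (τ.symm^[n + 1] ω) (ι u))) +
        coc σ L n (σ.symm^[n] ω)
          (L (σ.symm^[n + 1] ω) (ι u) - M (τ.symm^[n + 1] ω) (ι u)) := by
      rw [coc_symm_iterate_succ, coc_symm_iterate_succ]
      simp only [ContinuousLinearMap.comp_apply, map_sub]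
      abel
    rw [hsplit, Finset.sum_range_succ, add_mul]
    refine (norm_add_le _ _).trans (add_le_add ?_ ?_)
    · rw [hnext]
      exact ih (m + 1)
    · exact (hstep n u).trans (mul_le_mul_of_nonneg_left hu_norm (ha n))

end Cocycle

theorem sum_exp_mul_le {a : ℝ} (ha : 0 < a) (n : ℕ) :
    ∑ i ∈ Finset.range n, Real.exp (a * i) ≤ Real.exp (a * n) / (Real.exp a - 1) := by
  have h1 : 0 < Real.exp a - 1 := by linarith [Real.add_one_lt_exp ha.ne']
  have hpow : ∀ i : ℕ, Real.exp (a * i) = Real.exp a ^ i := fun i => by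
    rw [mul_comm, Real.exp_nat_mul]
  simp only [hpow]
  rw [geom_sum_eq (by linarith)]
  gcongr
  linarith

theorem sum_exp_neg_mul_exp_le {b l : ℝ} (hbl : b < l) (n : ℕ) :
    ∑ i ∈ Finset.range n, Real.exp (-l * i) * Real.exp (b * (i + 1 : ℕ)) ≤
      Real.exp b / (1 - Real.exp (b - l)) := by
  have hr : Real.exp (b - l) < 1 := Real.exp_lt_one_iff.2 (by linarith)
  have hterm : ∀ i : ℕ, Real.exp (-l * i) * Real.exp (b * (i + 1 : ℕ)) =
      Real.exp b * Real.exp (b - l) ^ i := fun i => by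
    rw [← Real.exp_nat_mul, ← Real.exp_add, ← Real.exp_add]
    push_cast
    ring_nf
  simp only [hterm]
  rw [← Finset.mul_sum, div_eq_mul_inv, ← tsum_geometric_of_lt_one (Real.exp_pos _).le hr]
  exact mul_le_mul_of_nonneg_left ((summable_geometric_of_lt_one (Real.exp_pos _).le hr).sum_le_tsum
    _ fun i _ => by positivity) (Real.exp_pos _).le

/-- Backward orbits of two nearby maps separate at most exponentially. -/
theorem dist_iterate_le {Ω : Type*} [MetricSpace Ω] (S T : Ω → Ω) {C a δ : ℝ} (hC : 0 ≤ C)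
    (ha : 0 < a) (hδ : 0 ≤ δ)
    (hS : ∀ (k : ℕ) (x y : Ω), dist (S^[k] x) (S^[k] y) ≤ C * Real.exp (a * k) * dist x y)
    (hST : ∀ y, dist (S y) (T y) ≤ δ) (n : ℕ) (z : Ω) :
    dist (S^[n] z) (T^[n] z) ≤ C / (Real.exp a - 1) * δ * Real.exp (a * n) := by
  have key : ∀ (n : ℕ) (z : Ω), dist (S^[n] z) (T^[n] z) ≤
      C * δ * ∑ i ∈ Finset.range n, Real.exp (a * i) := by
    intro n
    induction n with
    | zero => simp
    | succ n ih =>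
      intro z
      rw [Function.iterate_succ_apply, Function.iterate_succ_apply, Finset.sum_range_succ]
      have h1 := dist_triangle (S^[n] (S z)) (S^[n] (T z)) (T^[n] (T z))
      have h2 := hS n (S z) (T z)
      have h3 := mul_le_mul_of_nonneg_left (hST z)
        (mul_nonneg hC (Real.exp_pos (a * n)).le)
      have h4 := ih (T z)
      linarith
  calc _ ≤ _ := key n z
    _ ≤ C * δ * (Real.exp (a * n) / (Real.exp a - 1)) :=
        mul_le_mul_of_nonneg_left (sum_exp_mul_le ha n) (mul_nonneg hC hδ)
    _ = _ := by ring

theorem rpow_add_rpow_le {d e E a p : ℝ} {k : ℕ} (hd : 0 ≤ d) (he : 0 ≤ e) (hE : 0 ≤ E)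
    (ha : 0 ≤ a) (hp : 0 ≤ p) (hde : d ≤ E * e * Real.exp (a * k)) :
    e ^ p + d ^ p ≤ (1 + E ^ p) * e ^ p * Real.exp (a * p * k) := by
  have h1 : d ^ p ≤ E ^ p * e ^ p * Real.exp (a * p * k) := by
    refine (Real.rpow_le_rpow hd hde hp).trans_eq ?_
    rw [Real.mul_rpow (by positivity) (Real.exp_pos _).le, Real.mul_rpow hE he, ← Real.exp_mul]
    ring_nf
  have h2 : e ^ p ≤ e ^ p * Real.exp (a * p * k) :=
    le_mul_of_one_le_right (by positivity) (Real.one_le_exp (by positivity))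
  linarith

/-- The number of steps `n ~ |log ε|` for which `exp (-λ n) ≤ ε ^ p`. -/
theorem exists_nat_exp_neg_mul_le {e l p : ℝ} (he : 0 < e) (he1 : e ≤ Real.exp (-1))
    (hl : 0 < l) (hp : 0 ≤ p) :
    ∃ n : ℕ, Real.exp (-l * n) ≤ e ^ p ∧ (n : ℝ) ≤ (p / l + 1) * |Real.log e| ∧
      1 ≤ |Real.log e| := by
  have hlog : Real.log e ≤ -1 := (Real.log_le_iff_le_exp he).2 he1
  have habs : |Real.log e| = -Real.log e := abs_of_nonpos (by linarith)
  rw [habs]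
  refine ⟨⌈p * -Real.log e / l⌉₊, ?_, ?_, by linarith⟩
  · rw [Real.rpow_def_of_pos he]
    have h1 := Nat.le_ceil (p * -Real.log e / l)
    rw [div_le_iff₀ hl] at h1
    exact Real.exp_le_exp.2 (by linarith)
  · have h1 := Nat.ceil_lt_add_one (a := p * -Real.log e / l)
      (div_nonneg (mul_nonneg hp (by linarith)) hl.le)
    have h2 : (p / l + 1) * -Real.log e = p * -Real.log e / l + -Real.log e := by ring
    linarith

/-- quenched linear response (abstract form, Theorem 3):
‖h_{ω,ε} − h_ω − ε Γ_ω‖_w = O(|ln|ε||·|ε|^{1+ζ}) for ω ∈ Ω_ε ∩ Ω₀, where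
Γ_ω = Σ_{j≥0} L^j_{σ^{-j}ω} Λ_{ω,j} h_{σ^{-(j+1)}ω}. -/
theorem stmt11 {Ω Bw Bs Bss : Type*} [MetricSpace Ω] [Nonempty Ω]
    [NormedAddCommGroup Bw] [NormedSpace ℝ Bw] [CompleteSpace Bw]
    [NormedAddCommGroup Bs] [NormedSpace ℝ Bs]
    [NormedAddCommGroup Bss] [NormedSpace ℝ Bss]
    (ιs : Bss →L[ℝ] Bs) (ιw : Bs →L[ℝ] Bw)
    (hιs : ∀ g : Bss, ‖ιs g‖ ≤ ‖g‖) (hιw : ∀ g : Bs, ‖ιw g‖ ≤ ‖g‖)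
    (ψ : Bw →L[ℝ] ℝ) (hψ : ψ ≠ 0)
    (I : Set ℝ) (hI : (0 : ℝ) ∈ I)
    (σ : ℝ → Ω ≃ Ω) (Ωe : ℝ → Set Ω)
    (hinv : ∀ ε ∈ I, ∀ ω ∈ Ωe ε, (σ ε).symm ω ∈ Ωe ε ∧ (σ ε) ω ∈ Ωe ε)
    (Lw : ℝ → Ω → Bw →L[ℝ] Bw) (Ls : ℝ → Ω → Bs →L[ℝ] Bs)
    (hcompat : ∀ ε ∈ I, ∀ (ω : Ω) (g : Bs), ιw (Ls ε ω g) = Lw ε ω (ιw g))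
    (h : ℝ → Ω → Bs) (hss : Ω → Bss)
    (hss_comp : ∀ ω : Ω, ιs (hss ω) = h 0 ω)
    (C K Mb lam ζ c D₀ : ℝ) (hC : 0 < C) (hK : 0 < K)
    (hlam : 0 < lam) (hζ : 0 < ζ) (hζ1 : ζ ≤ 1)
    (hc : 0 ≤ c) (hclam : c < lam / (1 + ζ))
    (hbdd : ∀ x y : Ω, dist x y ≤ D₀)
    -- hypotheses of Theorem 1
    (hpres : ∀ ε ∈ I, ∀ (ω : Ω) (g : Bw), ψ (Lw ε ω g) = ψ g)
    (hdec : ∀ ε ∈ I, ∀ ω ∈ Ωe ε, ∀ (n : ℕ) (g : Bw), ψ g = 0 →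
      ‖coc (⇑(σ ε)) (Lw ε) n ω g‖ ≤ C * Real.exp (-lam * n) * ‖g‖)
    (hcont : ∀ ε ∈ I, ∀ ω ∈ Ωe ε, ∀ ω' ∈ Ωe 0, ∀ g : Bs,
      ‖Lw ε ω (ιw g) - Lw 0 ω' (ιw g)‖ ≤ C * (dist ω ω' ^ ζ + |ε| ^ ζ) * ‖g‖)
    (hnorm : ∀ ε ∈ I, ∀ ω ∈ Ωe ε, ψ (ιw (h ε ω)) = 1 ∧ ‖h ε ω‖ ≤ C)
    (hequiv : ∀ ε ∈ I, ∀ ω ∈ Ωe ε, Lw ε ω (ιw (h ε ω)) = ιw (h ε ((σ ε) ω)))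
    -- additional hypotheses of Theorem 3
    (hKbd : ∀ (ω : Ω) (j : ℕ), ‖coc (⇑(σ 0)) (Ls 0) j ω‖ ≤ K)
    (hssbd : ∀ ω : Ω, ‖hss ω‖ ≤ C)
    (Λ : Ω → ℕ → Bss →L[ℝ] Bs)
    (hΛbd : ∀ (ω : Ω) (j : ℕ), ‖Λ ω j‖ ≤ Mb)
    (hΛker : ∀ (ω : Ω) (j : ℕ) (g : Bss), ψ (ιw (Λ ω j g)) = 0)
    (hTay : ∀ ε ∈ I, ∀ (ω : Ω) (j : ℕ) (g : Bss),
      ‖Ls ε ((σ ε).symm^[j + 1] ω) (ιs g) - Ls 0 ((σ 0).symm^[j + 1] ω) (ιs g) -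
          ε • Λ ω j g‖ ≤
        C * (|ε| ^ (1 + ζ) +
          dist ((σ ε).symm^[j + 1] ω) ((σ 0).symm^[j + 1] ω) ^ (1 + ζ)) * ‖g‖)
    (hLip : ∀ (k : ℕ) (x y : Ω),
      dist ((σ 0).symm^[k] x) ((σ 0).symm^[k] y) ≤ C * Real.exp (c * k) * dist x y)
    (hdistC0 : ∀ ε ∈ I, ∀ y : Ω, dist ((σ 0).symm y) ((σ ε).symm y) ≤ C * |ε|) :
    ∃ K0 > 0, ∃ ε0 > 0, ∀ ε ∈ I, 0 < |ε| → |ε| ≤ ε0 → ∀ ω ∈ Ωe ε ∩ Ωe 0,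
      ‖ιw (h ε ω) - ιw (h 0 ω) -
          ε • (∑' j : ℕ, coc (⇑(σ 0)) (Lw 0) j ((σ 0).symm^[j] ω)
            (ιw (Λ ω j (hss ((σ 0).symm^[j + 1] ω)))))‖ ≤
        K0 * (abs (Real.log (abs ε))) * |ε| ^ (1 + ζ) := by
  obtain ⟨a, hca, ha_lt⟩ := exists_between hclam
  have ha : 0 < a := hc.trans_lt hca
  have hb : a * (1 + ζ) < lam := (lt_div_iff₀ (by linarith)).1 ha_lt
  have hb' : a * ζ < lam := by linarith [mul_add a 1 ζ]
  have hMb : 0 ≤ Mb := (norm_nonneg _).trans (hΛbd (Classical.arbitrary Ω) 0)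
  have hE1 : 0 < Real.exp a - 1 := by linarith [Real.add_one_lt_exp ha.ne']
  have hr : Real.exp (-lam) < 1 := Real.exp_lt_one_iff.2 (by linarith)
  have hr1 : 0 < 1 - Real.exp (-lam) := by linarith
  have hS1 : 0 < 1 - Real.exp (a * (1 + ζ) - lam) := by
    linarith [Real.exp_lt_one_iff.2 (show a * (1 + ζ) - lam < 0 by linarith)]
  have hS2 : 0 < 1 - Real.exp (a * ζ - lam) := by
    linarith [Real.exp_lt_one_iff.2 (show a * ζ - lam < 0 by linarith)]
  set E := C / (Real.exp a - 1) * C with hE_def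
  have hE : 0 ≤ E := by positivity
  set S1 := Real.exp (a * (1 + ζ)) / (1 - Real.exp (a * (1 + ζ) - lam)) with hS1_def
  set S2 := Real.exp (a * ζ) / (1 - Real.exp (a * ζ - lam)) with hS2_def
  have hS1' : 0 < S1 := by positivity
  have hS2' : 0 < S2 := by positivity
  set C1 := C ^ 3 * (1 + E ^ (1 + ζ)) * S1 with hC1_def
  set C2 := C ^ 2 * (1 + E ^ ζ) * S2 * (K * (Mb * C)) with hC2_def
  set C3 := C * (Mb * C) / (1 - Real.exp (-lam)) with hC3_def
  have hC1 : 0 ≤ C1 := by positivity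
  have hC2 : 0 ≤ C2 := by positivity
  have hC3 : 0 ≤ C3 := by positivity
  refine ⟨2 * C ^ 2 + C1 + C2 * ((1 + ζ) / lam + 1) + C3, by positivity,
    Real.exp (-1), Real.exp_pos _, ?_⟩
  rintro ε hε hε0 hε1 ω ⟨hωε, hω0⟩
  have hy : ∀ n, (σ ε).symm^[n] ω ∈ Ωe ε := fun n => by
    induction n with
    | zero => exact hωε
    | succ n ih => rw [Function.iterate_succ_apply']; exact (hinv ε hε _ ih).1
  have hx : ∀ n, (σ 0).symm^[n] ω ∈ Ωe 0 := fun n => by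
    induction n with
    | zero => exact hω0
    | succ n ih => rw [Function.iterate_succ_apply']; exact (hinv 0 hI _ ih).1
  have hdist : ∀ k : ℕ, dist ((σ ε).symm^[k] ω) ((σ 0).symm^[k] ω) ≤
      E * |ε| * Real.exp (a * k) := fun k => by
    have := dist_iterate_le (σ 0).symm (σ ε).symm hC.le ha (δ := C * |ε|) (by positivity)
      (fun k x y => (hLip k x y).trans (by gcongr)) (hdistC0 ε hε) k ω
    rw [dist_comm]
    exact this.trans_eq (by rw [hE_def]; ring)
  set A : ℕ → Bw →L[ℝ] Bw := fun j => coc (σ ε) (Lw ε) j ((σ ε).symm^[j] ω) with hA_def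
  set B : ℕ → Bw →L[ℝ] Bw := fun j => coc (σ 0) (Lw 0) j ((σ 0).symm^[j] ω) with hB_def
  set g : ℕ → Bs := fun j => Λ ω j (hss ((σ 0).symm^[j + 1] ω)) with hg_def
  have hA : ∀ n u, ψ u = 0 → ‖A n u‖ ≤ C * Real.exp (-lam * n) * ‖u‖ :=
    fun n u => hdec ε hε _ (hy n) n u
  have hgn : ∀ j, ‖g j‖ ≤ Mb * C := fun j =>
    (ContinuousLinearMap.le_opNorm _ _).trans
      (mul_le_mul (hΛbd _ _) (hssbd _) (norm_nonneg _) hMb)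
  have hgψ : ∀ j, ψ (ιw (g j)) = 0 := fun j => hΛker _ _ _
  -- differences of the two cocycles
  have hAB : ∀ n, ‖A n (ιw (g n)) - B n (ιw (g n))‖ ≤ C2 * |ε| ^ ζ := fun n => by
    have hstep : ∀ i (u : Bs), ‖A i (Lw ε ((σ ε).symm^[i + 1] ω) (ιw u) -
        Lw 0 ((σ 0).symm^[i + 1] ω) (ιw u))‖ ≤
        C ^ 2 * (1 + E ^ ζ) * |ε| ^ ζ *
          (Real.exp (-lam * i) * Real.exp (a * ζ * (i + 1 : ℕ))) * ‖u‖ := fun i u => by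
      refine (hA i _ (by rw [map_sub, hpres ε hε, hpres 0 hI, sub_self])).trans ?_
      have h1 := hcont ε hε _ (hy (i + 1)) _ (hx (i + 1)) u
      have h2 := rpow_add_rpow_le dist_nonneg (abs_nonneg ε) hE ha.le hζ.le (hdist (i + 1))
      rw [add_comm] at h2
      calc _ ≤ C * Real.exp (-lam * i) * (C * ((1 + E ^ ζ) * |ε| ^ ζ *
            Real.exp (a * ζ * (i + 1 : ℕ))) * ‖u‖) := by
            gcongr
            exact h1.trans (by gcongr)
        _ = _ := by ring
    refine (norm_coc_sub_coc_le ιw (σ ε) (σ 0) (Lw ε) (Lw 0) (Ls 0) (hcompat 0 hI) hKbd ω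
      _ (fun i => by positivity) hstep n (g n)).trans ?_
    rw [← Finset.mul_sum]
    calc _ ≤ C ^ 2 * (1 + E ^ ζ) * |ε| ^ ζ * S2 * (K * (Mb * C)) := by
          gcongr
          · exact sum_exp_neg_mul_exp_le hb' n
          · exact hgn n
      _ = _ := by rw [hC2_def]; ring
  -- tail of the series defining the derivative
  have htail : ∀ n, ‖∑ j ∈ Finset.range n, B j (ιw (g j)) - ∑' j, B j (ιw (g j))‖ ≤
      C3 * Real.exp (-lam * n) := fun n => by
    have hterm : ∀ j, ‖B j (ιw (g j))‖ ≤ C * (Mb * C) * Real.exp (-lam) ^ j := fun j => by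
      refine (hdec 0 hI _ (hx j) j _ (hgψ j)).trans ?_
      rw [← Real.exp_nat_mul, mul_comm (j : ℝ)]
      calc _ ≤ C * Real.exp (-lam * j) * (Mb * C) := by
            gcongr
            exact (hιw _).trans (hgn j)
        _ = _ := by ring
    have hsum : Summable fun j => B j (ιw (g j)) :=
      .of_norm_bounded ((summable_geometric_of_lt_one (Real.exp_pos _).le hr).mul_left _) hterm
    refine (norm_sub_le_of_geometric_bound_of_hasSum hr hterm hsum.hasSum n).trans_eq ?_
    rw [← Real.exp_nat_mul, mul_comm (n : ℝ), hC3_def]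
    ring
  -- Taylor remainders
  set R : ℕ → Bs := fun j =>
    Ls ε ((σ ε).symm^[j + 1] ω) (ιs (hss ((σ 0).symm^[j + 1] ω))) -
      Ls 0 ((σ 0).symm^[j + 1] ω) (ιs (hss ((σ 0).symm^[j + 1] ω))) - ε • g j with hR_def
  have hRsum : ∀ n, ‖∑ j ∈ Finset.range n, A j (ιw (R j))‖ ≤ C1 * |ε| ^ (1 + ζ) := fun n => by
    have hRj : ∀ j ∈ Finset.range n, ‖A j (ιw (R j))‖ ≤ C ^ 3 * (1 + E ^ (1 + ζ)) *
        |ε| ^ (1 + ζ) *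
          (Real.exp (-lam * j) * Real.exp (a * (1 + ζ) * (j + 1 : ℕ))) := fun j _ => by
      have hker : ψ (ιw (R j)) = 0 := by
        simp only [hR_def, map_sub, map_smul, hcompat ε hε, hcompat 0 hI, hpres ε hε,
          hpres 0 hI, hgψ, smul_zero, sub_self]
      have h1 := hTay ε hε ω j (hss ((σ 0).symm^[j + 1] ω))
      have h2 := rpow_add_rpow_le dist_nonneg (abs_nonneg ε) hE ha.le
        (show 0 ≤ 1 + ζ by linarith) (hdist (j + 1))
      refine (hA j _ hker).trans ?_
      calc _ ≤ C * Real.exp (-lam * j) * (C * ((1 + E ^ (1 + ζ)) * |ε| ^ (1 + ζ) *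
            Real.exp (a * (1 + ζ) * (j + 1 : ℕ))) * C) := by
            gcongr
            exact (hιw _).trans (h1.trans (by gcongr; exact hssbd _))
        _ = _ := by ring
    refine (norm_sum_le_of_le _ hRj).trans ?_
    rw [← Finset.mul_sum]
    calc _ ≤ C ^ 3 * (1 + E ^ (1 + ζ)) * |ε| ^ (1 + ζ) * S1 := by
          gcongr
          exact sum_exp_neg_mul_exp_le hb n
      _ = _ := by rw [hC1_def]; ring
  obtain ⟨n, hn_exp, hn_le, hlog⟩ :=
    exists_nat_exp_neg_mul_le hε0 hε1 hlam (show 0 ≤ 1 + ζ by linarith)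
  have hmain : ιw (h ε ω) - ιw (h 0 ω) - ε • ∑' j, B j (ιw (g j)) =
      A n (ιw (h ε ((σ ε).symm^[n] ω)) - ιw (h 0 ((σ 0).symm^[n] ω))) +
      ∑ j ∈ Finset.range n, A j (ιw (R j)) +
      ε • ((∑ j ∈ Finset.range n, (A j (ιw (g j)) - B j (ιw (g j)))) +
        (∑ j ∈ Finset.range n, B j (ιw (g j)) - ∑' j, B j (ιw (g j)))) := by
    have htel := equivariant_sub_eq_sum (σ ε) (σ 0) (Lw ε) (fun z => ιw (h ε z))
      (fun z => ιw (h 0 z)) ω (fun n => by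
        rw [hequiv ε hε _ (hy (n + 1)), Function.iterate_succ_apply', Equiv.apply_symm_apply]) n
    have hincr : ∀ j, Lw ε ((σ ε).symm^[j + 1] ω) (ιw (h 0 ((σ 0).symm^[j + 1] ω))) -
        ιw (h 0 ((σ 0).symm^[j] ω)) = ιw (R j) + ε • ιw (g j) := fun j => by
      have h0 := hequiv 0 hI _ (hx (j + 1))
      rw [Function.iterate_succ_apply', Equiv.apply_symm_apply,
        ← Function.iterate_succ_apply' (σ 0).symm] at h0
      simp only [hR_def, map_sub, map_smul, hss_comp, hcompat ε hε, hcompat 0 hI, sub_add_cancel]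
      rw [h0]
    simp only [hincr, map_add, map_smul, Finset.sum_add_distrib, ← Finset.smul_sum] at htel
    rw [htel, Finset.sum_sub_distrib, smul_add, smul_sub, smul_sub]
    abel
  have hfirst : ‖A n (ιw (h ε ((σ ε).symm^[n] ω)) - ιw (h 0 ((σ 0).symm^[n] ω)))‖ ≤
      2 * C ^ 2 * |ε| ^ (1 + ζ) := by
    have h1 := hnorm ε hε _ (hy n)
    have h2 := hnorm 0 hI _ (hx n)
    refine (hA n _ (by rw [map_sub, h1.1, h2.1, sub_self])).trans ?_
    calc _ ≤ C * |ε| ^ (1 + ζ) * (C + C) := by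
          gcongr
          exact norm_sub_le_of_le ((hιw _).trans h1.2) ((hιw _).trans h2.2)
      _ = _ := by ring
  have hdiff : ‖∑ j ∈ Finset.range n, (A j (ιw (g j)) - B j (ιw (g j)))‖ ≤
      n * (C2 * |ε| ^ ζ) := by
    simpa using norm_sum_le_of_le (Finset.range n) fun j _ => hAB j
  have hε_le : |ε| ≤ 1 := hε1.trans (Real.exp_le_one_iff.2 (by norm_num))
  have hpow : |ε| * |ε| ^ ζ = |ε| ^ (1 + ζ) := by
    rw [Real.rpow_add hε0, Real.rpow_one]
  set l := |Real.log (|ε|)| with hl_def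
  set P := |ε| ^ (1 + ζ) with hP_def
  have hP : 0 ≤ P := by positivity
  have hPl : P ≤ l * P := le_mul_of_one_le_left hP hlog
  change ‖ιw (h ε ω) - ιw (h 0 ω) - ε • ∑' j, B j (ιw (g j))‖ ≤ _
  rw [hmain]
  refine (norm_add₃_le).trans ?_
  rw [norm_smul, Real.norm_eq_abs]
  calc _ ≤ 2 * C ^ 2 * P + C1 * P +
        |ε| * (n * (C2 * |ε| ^ ζ) + C3 * Real.exp (-lam * n)) := by
        gcongr
        · exact hRsum n
        · exact norm_add_le_of_le hdiff (htail n)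
    _ = 2 * C ^ 2 * P + C1 * P + C2 * n * P + |ε| * (C3 * Real.exp (-lam * n)) := by
        rw [← hpow]; ring
    _ ≤ 2 * C ^ 2 * (l * P) + C1 * (l * P) + C2 * (((1 + ζ) / lam + 1) * l) * P +
        1 * (C3 * (l * P)) := by
        gcongr
        exact hn_exp.trans hPl
    _ = _ := by ring
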